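/- Let (K_k)_{k ∈ ℕ} be a countable family of nonempty compact Hausdorff spaces and let (n_k)_{k ∈ ℕ} be a sequence of positive integers bounded above by some N. Then there exist a compact Hausdorff space K and an isomorphism of Banach spaces from the ℓ∞-direct sum of the family (C(K_k, M_{n_k}(ℂ)))_{k ∈ ℕ} onto C(K, ℂ). -/

import Mathlib

set_option synthInstance.maxHeartbeats 1000000
set_option maxHeartbeats 1000000

open scoped Matrix.Norms.L2Operator ENNReal

theorem Matrix.norm_entry_le_l2_opNorm {ι : Type*} [Fintype ι] [DecidableEq ι]
    (A : Matrix ι ι ℂ) (i j : ι) : ‖A i j‖ ≤ ‖A‖ := by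
  have h := A.l2_opNorm_mulVec (EuclideanSpace.single j (1 : ℂ))
  have hi := PiLp.norm_apply_le
    ((EuclideanSpace.equiv ι ℂ).symm (A.mulVec (EuclideanSpace.single j (1 : ℂ)))) i
  simpa using hi.trans h

theorem Matrix.l2_opNorm_single_one_le {ι : Type*} [Fintype ι] [DecidableEq ι] (i j : ι) :
    ‖(Matrix.single i j 1 : Matrix ι ι ℂ)‖ ≤ 1 := by
  have h := Matrix.l2_opNorm_conjTranspose_mul_self (Matrix.single i j 1 : Matrix ι ι ℂ)
  rw [Matrix.conjTranspose_single, Matrix.single_mul_single_same, star_one, mul_one,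
    ← Matrix.diagonal_single, Matrix.l2_opNorm_diagonal, Pi.norm_single, norm_one] at h
  nlinarith [norm_nonneg (Matrix.single i j 1 : Matrix ι ι ℂ)]

theorem Matrix.l2_opNorm_le_of_norm_entry_le {ι : Type*} [Fintype ι] [DecidableEq ι]
    {A : Matrix ι ι ℂ} {C : ℝ} (h : ∀ i j, ‖A i j‖ ≤ C) :
    ‖A‖ ≤ (Fintype.card ι : ℝ) ^ 2 * C := by
  calc ‖A‖ = ‖∑ i, ∑ j, A i j • (Matrix.single i j 1 : Matrix ι ι ℂ)‖ := by
        conv_lhs => rw [Matrix.matrix_eq_sum_single A]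
        simp [Matrix.smul_single]
    _ ≤ ∑ i : ι, ∑ j : ι, C := by
        refine norm_sum_le_of_le _ fun i _ => norm_sum_le_of_le _ fun j _ => ?_
        rw [norm_smul]
        exact (mul_le_of_le_one_right (norm_nonneg _)
          (Matrix.l2_opNorm_single_one_le i j)).trans (h i j)
    _ = (Fintype.card ι : ℝ) ^ 2 * C := by simp [sq, mul_assoc]

/-- A bounded continuous function extends to the Stone–Čech compactification. -/
theorem exists_stoneCech_extension {X : Type*} [TopologicalSpace X] {f : X → ℂ}
    (hf : Continuous f) {C : ℝ} (hC : ∀ x, ‖f x‖ ≤ C) :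
    ∃ g : C(StoneCech X, ℂ), ∀ x, g (stoneCechUnit x) = f x := by
  have hmem : ∀ x, f x ∈ Metric.closedBall (0 : ℂ) C := by simpa using hC
  have : CompactSpace (Metric.closedBall (0 : ℂ) C) :=
    isCompact_iff_compactSpace.mp (isCompact_closedBall 0 C)
  have hc : Continuous fun x => (⟨f x, hmem x⟩ : Metric.closedBall (0 : ℂ) C) :=
    hf.subtype_mk hmem
  exact ⟨⟨fun y => (stoneCechExtend hc y).val,
    continuous_subtype_val.comp (continuous_stoneCechExtend hc)⟩,
    fun x => congrArg Subtype.val (stoneCechExtend_stoneCechUnit hc x)⟩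

section MatrixFamily

variable (K : ℕ → Type) [∀ k, TopologicalSpace (K k)] (n : ℕ → ℕ)

/-- The points of the spaces `K k` together with a matrix position of size `n k`. -/
abbrev EntrySpace : Type := Σ k, K k × Fin (n k) × Fin (n k)

/-- The matrix-valued function on `K k` whose entries are the values of `g`. -/
noncomputable def matrixRestriction (g : C(StoneCech (EntrySpace K n), ℂ)) (k : ℕ) :
    C(K k, Matrix (Fin (n k)) (Fin (n k)) ℂ) where
  toFun x := Matrix.of fun i j => g (stoneCechUnit ⟨k, x, i, j⟩)
  continuous_toFun := continuous_matrix fun i j => g.continuous.comp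
    (continuous_stoneCechUnit.comp (continuous_sigmaMk.comp (by fun_prop)))

variable [∀ k, CompactSpace (K k)]

variable {K n} in
theorem norm_matrixRestriction_le {N : ℕ} (hN : ∀ k, n k ≤ N)
    (g : C(StoneCech (EntrySpace K n), ℂ)) (k : ℕ) :
    ‖matrixRestriction K n g k‖ ≤ (N : ℝ) ^ 2 * ‖g‖ := by
  refine (ContinuousMap.norm_le _ (by positivity)).mpr fun x => ?_
  refine (Matrix.l2_opNorm_le_of_norm_entry_le (C := ‖g‖) fun i j =>
    g.norm_coe_le_norm _).trans ?_
  have : (n k : ℝ) ≤ N := by exact_mod_cast hN k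
  rw [Fintype.card_fin]
  gcongr

/-- The restrictions of a function on the Stone–Čech compactification, as an element of the
`ℓ∞`-direct sum. -/
noncomputable def matrixRestrictionCLM {N : ℕ} (hN : ∀ k, n k ≤ N) :
    C(StoneCech (EntrySpace K n), ℂ) →L[ℂ]
      lp (fun k => C(K k, Matrix (Fin (n k)) (Fin (n k)) ℂ)) ∞ :=
  LinearMap.mkContinuous
    { toFun := fun g => ⟨matrixRestriction K n g, memℓp_infty
        ⟨(N : ℝ) ^ 2 * ‖g‖, Set.forall_mem_range.mpr (norm_matrixRestriction_le hN g)⟩⟩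
      map_add' := fun _ _ => rfl
      map_smul' := fun _ _ => rfl }
    ((N : ℝ) ^ 2)
    fun g => lp.norm_le_of_forall_le (by positivity) (norm_matrixRestriction_le hN g)

variable {K n} in
theorem matrixRestrictionCLM_apply {N : ℕ} (hN : ∀ k, n k ≤ N)
    (g : C(StoneCech (EntrySpace K n), ℂ)) (k : ℕ) (x : K k) (i j : Fin (n k)) :
    matrixRestrictionCLM K n hN g k x i j = g (stoneCechUnit ⟨k, x, i, j⟩) := rfl

theorem matrixRestrictionCLM_injective {N : ℕ} (hN : ∀ k, n k ≤ N) :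
    Function.Injective (matrixRestrictionCLM K n hN) := by
  intro g₁ g₂ h
  refine ContinuousMap.coe_injective (stoneCech_hom_ext g₁.continuous g₂.continuous ?_)
  funext ⟨k, x, i, j⟩
  simp only [Function.comp_apply, ← matrixRestrictionCLM_apply hN, h]

theorem matrixRestrictionCLM_surjective {N : ℕ} (hN : ∀ k, n k ≤ N) :
    Function.Surjective (matrixRestrictionCLM K n hN) := by
  intro f
  have hc : Continuous fun p : EntrySpace K n => f p.1 p.2.1 p.2.2.1 p.2.2.2 := by
    refine continuous_sigma fun k => ?_
    refine continuous_prod_of_discrete_right.mpr fun q => ?_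
    exact (f k).continuous.matrix_elem q.1 q.2
  obtain ⟨g, hg⟩ := exists_stoneCech_extension hc (C := ‖f‖) fun p =>
    (Matrix.norm_entry_le_l2_opNorm _ _ _).trans <|
      ((f p.1).norm_coe_le_norm _).trans (lp.norm_apply_le_norm ENNReal.top_ne_zero f _)
  refine ⟨g, ?_⟩
  ext k x i j
  exact hg ⟨k, x, i, j⟩

end MatrixFamily

theorem stmt_15 (K : ℕ → Type) [∀ k, TopologicalSpace (K k)]
    [∀ k, CompactSpace (K k)] [∀ k, T2Space (K k)] [∀ k, Nonempty (K k)]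
    (n : ℕ → ℕ) (hn : ∀ k, 0 < n k) (N : ℕ) (hN : ∀ k, n k ≤ N) :
    ∃ (L : Type) (_ : TopologicalSpace L) (_ : CompactSpace L) (_ : T2Space L),
      Nonempty ((lp (fun k => C(K k, Matrix (Fin (n k)) (Fin (n k)) ℂ)) ∞) ≃L[ℂ] C(L, ℂ)) := by
  have (k : ℕ) : CompleteSpace (Matrix (Fin (n k)) (Fin (n k)) ℂ) :=
    FiniteDimensional.complete ℂ _
  exact ⟨StoneCech (EntrySpace K n), inferInstance, inferInstance, inferInstance,
    ⟨(ContinuousLinearEquiv.ofBijective (matrixRestrictionCLM K n hN)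
      (LinearMap.ker_eq_bot.mpr (matrixRestrictionCLM_injective K n hN))
      (LinearMap.range_eq_top.mpr (matrixRestrictionCLM_surjective K n hN))).symm⟩⟩
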